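/- arXiv:hep-th/0602093 — 2 statements merged into one kernel-verified Lean document; each statement's English description precedes it below -/
import Mathlib

section
/- For all α, x ∈ ℂ with |Im α| + |Im x| < 1/(2b) and every admissible ε, the functional equation D_α(x + ib/2)·cosh(πb(x − α)) = D_α(x − ib/2)·cosh(πb(x + α)) holds. -/
open MeasureTheory

/-- The function `D_α` (defined for `|Im α| + |Im z| < Q/2`, `Q = b + b⁻¹`,
via a regularized contour integral over `ℝ + iε`). -/
noncomputable def Dfun (b ε : ℝ) (α z : ℂ) : ℂ :=
  Complex.exp (Complex.I *
    ∫ t : ℝ,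
      Complex.cos (2 * ((t : ℂ) + Complex.I * (ε : ℂ)) * z) *
          Complex.sin (2 * α * ((t : ℂ) + Complex.I * (ε : ℂ))) /
        (2 * ((t : ℂ) + Complex.I * (ε : ℂ)) *
          Complex.sinh ((b : ℂ) * ((t : ℂ) + Complex.I * (ε : ℂ))) *
          Complex.sinh (((t : ℂ) + Complex.I * (ε : ℂ)) / (b : ℂ))))


namespace DF
open Filter Topology

lemma norm_cexp_le (u : ℂ) : ‖Complex.exp u‖ ≤ Real.exp |u.re| := by
  rw [Complex.norm_exp]; exact Real.exp_le_exp.2 (le_abs_self _)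

lemma norm_cos_le (u : ℂ) : ‖Complex.cos u‖ ≤ Real.exp |u.im| := by
  have h1 := norm_cexp_le (u * Complex.I)
  have h2 := norm_cexp_le (-u * Complex.I)
  have h3 := norm_add_le (Complex.exp (u * Complex.I)) (Complex.exp (-u * Complex.I))
  simp only [Complex.mul_re, Complex.I_re, Complex.I_im, mul_zero, mul_one, zero_sub,
    Complex.neg_im, abs_neg, neg_neg] at h1 h2
  rw [Complex.cos, norm_div]
  simp only [Complex.norm_ofNat]
  linarith

lemma norm_sin_le (u : ℂ) : ‖Complex.sin u‖ ≤ Real.exp |u.im| := by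
  have h1 := norm_cexp_le (u * Complex.I)
  have h2 := norm_cexp_le (-u * Complex.I)
  have h3 := norm_sub_le (Complex.exp (-u * Complex.I)) (Complex.exp (u * Complex.I))
  simp only [Complex.mul_re, Complex.I_re, Complex.I_im, mul_zero, mul_one, zero_sub,
    Complex.neg_im, abs_neg, neg_neg] at h1 h2
  rw [Complex.sin, norm_div, norm_mul]
  simp only [Complex.norm_ofNat, Complex.norm_I, mul_one]
  linarith

lemma sinh_nsq (u : ℂ) : ‖Complex.sinh u‖ ^ 2 = Real.sinh u.re ^ 2 + Real.sin u.im ^ 2 := by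
  have h : Complex.sinh u = ((Real.sinh u.re * Real.cos u.im : ℝ) : ℂ) +
      ((Real.cosh u.re * Real.sin u.im : ℝ) : ℂ) * Complex.I := by
    conv_lhs => rw [← Complex.re_add_im u]
    rw [Complex.sinh_add, Complex.cosh_mul_I, Complex.sinh_mul_I]
    push_cast; ring
  rw [h, Complex.sq_norm, Complex.normSq_add_mul_I]
  have h1 := Real.cosh_sq u.re
  have h2 := Real.sin_sq_add_cos_sq u.im
  rw [mul_pow, mul_pow, h1]
  linear_combination (Real.sinh u.re ^ 2) * h2

lemma sinh_lb2 (u : ℂ) : |Real.sinh u.re| ≤ ‖Complex.sinh u‖ := by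
  refine abs_le_of_sq_le_sq ?_ (norm_nonneg _)
  rw [sinh_nsq]; nlinarith [sq_nonneg (Real.sin u.im)]

lemma sinh_lb (c e : ℝ) (h0 : 0 < c * e) (h1 : c * e < Real.pi) (t : ℝ) :
    Real.sin (c * e) / 2 * Real.exp (c * |t|) ≤ ‖Complex.sinh ((c:ℂ) * ((t:ℂ) + Complex.I * (e:ℂ)))‖ := by
  have hs := Real.sin_pos_of_pos_of_lt_pi h0 h1
  have hs1 := Real.sin_le_one (c * e)
  have hre : ((c:ℂ) * ((t:ℂ) + Complex.I * (e:ℂ))).re = c * t := by simp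
  have him : ((c:ℂ) * ((t:ℂ) + Complex.I * (e:ℂ))).im = c * e := by simp
  have key : Real.sin (c * e) * Real.cosh (c * t) ≤ ‖Complex.sinh ((c:ℂ) * ((t:ℂ) + Complex.I * (e:ℂ)))‖ := by
    refine le_trans (le_abs_self _) (abs_le_of_sq_le_sq ?_ (norm_nonneg _))
    rw [sinh_nsq, hre, him, mul_pow, Real.cosh_sq]
    have : Real.sin (c * e) ^ 2 ≤ 1 := by nlinarith
    nlinarith [sq_nonneg (Real.sinh (c * t))]
  refine le_trans ?_ key
  have h3 : Real.exp (c * |t|) / 2 ≤ Real.cosh (c * t) := by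
    rw [Real.cosh_eq]
    rcases abs_cases t with ⟨h, _⟩ | ⟨h, _⟩ <;> rw [h]
    · linarith [Real.exp_pos (-(c * t))]
    · rw [mul_neg]; linarith [Real.exp_pos (c * t)]
  nlinarith

lemma int_exp (d : ℝ) (hd : 0 < d) : Integrable (fun t : ℝ => Real.exp (-d * |t|)) := by
  have h1 : IntegrableOn (fun t : ℝ => Real.exp (-d * |t|)) (Set.Ioi 0) := by
    refine (exp_neg_integrableOn_Ioi 0 hd).congr_fun ?_ measurableSet_Ioi
    intro t ht
    simp only [abs_of_pos (Set.mem_Ioi.1 ht)]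
  have h2 : IntegrableOn (fun t : ℝ => Real.exp (-d * |t|)) (Set.Iio 0) := by
    have := ((Measure.measurePreserving_neg (volume : Measure ℝ)).integrableOn_comp_preimage
      (MeasurableEquiv.neg ℝ).measurableEmbedding (s := Set.Ioi 0)
      (f := fun t : ℝ => Real.exp (-d * |t|))).2 h1
    simpa [Function.comp_def] using this
  have h3 := h2.union ((integrableOn_singleton (by simp) (hx := by simp) : IntegrableOn
    (fun t : ℝ => Real.exp (-d * |t|)) {0}).union h1)
  rw [← integrableOn_univ]
  refine h3.mono_set ?_
  intro t _
  rcases lt_trichotomy t 0 with h | h | h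
  · exact Or.inl h
  · exact Or.inr (Or.inl h)
  · exact Or.inr (Or.inr h)

lemma shift (f : ℂ → ℂ) (p q : ℝ) (hpq : p ≤ q) (C d T : ℝ) (hd : 0 < d)
    (hf : DifferentiableOn ℂ f {z | z.im ∈ Set.Icc p q})
    (hb : ∀ t : ℝ, T ≤ |t| → ∀ y ∈ Set.Icc p q, ‖f (t + Complex.I * (y:ℂ))‖ ≤ C * Real.exp (-d * |t|))
    (hp : Integrable (fun t : ℝ => f (t + Complex.I * (p:ℂ))))
    (hq : Integrable (fun t : ℝ => f (t + Complex.I * (q:ℂ)))) :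
    ∫ t : ℝ, f (t + Complex.I * (p:ℂ)) = ∫ t : ℝ, f (t + Complex.I * (q:ℂ)) := by
  have hrect : ∀ R : ℝ, ‖(∫ t in (-R)..R, f (t + Complex.I * (p:ℂ))) - 
      ∫ t in (-R)..R, f (t + Complex.I * (q:ℂ))‖ = 
      ‖(∫ y in p..q, f (((-R : ℝ) : ℂ) + Complex.I * (y:ℂ))) - ∫ y in p..q, f (((R : ℝ) : ℂ) + Complex.I * (y:ℂ))‖ := by
    intro R
    have := Complex.integral_boundary_rect_eq_zero_of_differentiableOn f ⟨-R, p⟩ ⟨R, q⟩ (hf.mono ?_)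
    · simp only [smul_eq_mul, mul_comm _ Complex.I] at this
      have h2 : (∫ t in (-R)..R, f (t + Complex.I * (p:ℂ))) - 
        ∫ t in (-R)..R, f (t + Complex.I * (q:ℂ)) = Complex.I * ((∫ y in p..q, f (((-R : ℝ) : ℂ) + Complex.I * (y:ℂ))) - ∫ y in p..q, f (((R : ℝ) : ℂ) + Complex.I * (y:ℂ))) := by
        linear_combination this
      rw [h2, norm_mul, Complex.norm_I, one_mul]
    · intro z hz
      have := hz.2
      simpa [Set.uIcc_of_le hpq] using this
  have h1 := (intervalIntegral_tendsto_integral hp tendsto_neg_atTop_atBot tendsto_id).sub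
     (intervalIntegral_tendsto_integral hq tendsto_neg_atTop_atBot tendsto_id)
  have h2 : Tendsto (fun R : ℝ => (∫ t in (-R)..R, f (t + Complex.I * (p:ℂ))) - 
      ∫ t in (-R)..R, f (t + Complex.I * (q:ℂ))) atTop (𝓝 0) := by
    rw [tendsto_zero_iff_norm_tendsto_zero]
    simp_rw [hrect]
    have h3 : Tendsto (fun R : ℝ => 2 * (C * Real.exp (-d * R) * |q - p|)) atTop (𝓝 0) := by
      have : Tendsto (fun R : ℝ => Real.exp (-d * R)) atTop (𝓝 0) := by
        apply Real.tendsto_exp_atBot.comp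
        exact tendsto_id.const_mul_atTop_of_neg (by linarith)
      simpa using ((this.const_mul C).mul_const |q - p|).const_mul 2
    refine squeeze_zero' (Eventually.of_forall fun _ => norm_nonneg _) ?_ h3
    filter_upwards [eventually_ge_atTop T, eventually_ge_atTop 0] with R hR hR0
    have e1 : ∀ r : ℝ, |r| = R → ‖∫ y in p..q, f ((r : ℂ) + Complex.I * (y:ℂ))‖ ≤ C * Real.exp (-d * R) * |q - p| := by
      intro r hr
      apply intervalIntegral.norm_integral_le_of_norm_le_const
      intro y hy
      rw [Set.uIoc_of_le hpq] at hy
      have := hb r (hr ▸ hR) y ⟨hy.1.le, hy.2⟩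
      rwa [hr] at this
    have a1 := e1 (-R) (by rw [abs_neg, abs_of_nonneg hR0])
    have a2 := e1 R (by rw [abs_of_nonneg hR0])
    refine (norm_sub_le _ _).trans ?_
    linarith
  have := tendsto_nhds_unique h1 h2
  exact sub_eq_zero.1 this

lemma int_of_bound (f : ℝ → ℂ) (hf : Continuous f) (C d : ℝ) (hd : 0 < d) 
    (hb : ∀ t, ‖f t‖ ≤ C * Real.exp (-d * |t|)) : Integrable f :=
  ((int_exp d hd).const_mul C).mono' hf.aestronglyMeasurable (Eventually.of_forall hb)


lemma quot_bound (N D : ℂ) (A m P c t : ℝ) (hm : 0 < m) (hN : ‖N‖ ≤ A * Real.exp (P * |t|))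
    (hD : m * Real.exp (c * |t|) ≤ ‖D‖) : ‖N / D‖ ≤ A / m * Real.exp (-(c - P) * |t|) := by
  have hpos : 0 < m * Real.exp (c * |t|) := by positivity
  rw [norm_div]
  calc ‖N‖ / ‖D‖ ≤ (A * Real.exp (P * |t|)) / (m * Real.exp (c * |t|)) := by
        apply div_le_div₀ ((norm_nonneg _).trans hN) hN hpos hD
    _ = A / m * Real.exp (-(c - P) * |t|) := by
        rw [show -(c - P) * |t| = P * |t| - c * |t| by ring, Real.exp_sub]
        field_simp

lemma im_bd (y t : ℝ) (z : ℂ) :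
    |(2 * ((t:ℂ) + Complex.I * (y:ℂ)) * z).im| ≤ 2 * |y| * |z.re| + 2 * |z.im| * |t| := by
  have : (2 * ((t:ℂ) + Complex.I * (y:ℂ)) * z).im = 2 * (y * z.re) + 2 * (z.im * t) := by
    simp; ring
  rw [this]
  refine (abs_add_le _ _).trans ?_
  rw [abs_mul, abs_mul, abs_mul, abs_mul, abs_two]
  apply le_of_eq; ring

lemma exp_bd (y t : ℝ) (z : ℂ) :
    Real.exp |(2 * ((t:ℂ) + Complex.I * (y:ℂ)) * z).im| ≤
      Real.exp (2 * |y| * |z.re|) * Real.exp (2 * |z.im| * |t|) := by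
  rw [← Real.exp_add]; exact Real.exp_le_exp.2 (im_bd y t z)

lemma nexp_bd (y t : ℝ) (z : ℂ) :
    ‖Complex.exp (Complex.I * (2 * ((t:ℂ) + Complex.I * (y:ℂ)) * z))‖ ≤
      Real.exp (2 * |y| * |z.re|) * Real.exp (2 * |z.im| * |t|) := by
  refine (norm_cexp_le _).trans ?_
  have := exp_bd y t z
  rwa [show |(Complex.I * (2 * ((t:ℂ) + Complex.I * (y:ℂ)) * z)).re| =
    |(2 * ((t:ℂ) + Complex.I * (y:ℂ)) * z).im| by rw [Complex.I_mul_re, abs_neg]]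

lemma sinh_ne (c e : ℝ) (h0 : 0 < c * e) (h1 : c * e < Real.pi) (t : ℝ) :
    Complex.sinh ((c:ℂ) * ((t:ℂ) + Complex.I * (e:ℂ))) ≠ 0 := by
  have := sinh_lb c e h0 h1 t
  have hs := Real.sin_pos_of_pos_of_lt_pi h0 h1
  rw [← norm_pos_iff]
  exact lt_of_lt_of_le (by positivity) this

/-- The integrand for `A`. -/
lemma intA (c e : ℝ) (h0 : 0 < c * e) (h1 : c * e < Real.pi) (w : ℂ) (hw : 2 * |w.im| < c) :
    Integrable (fun t : ℝ => Complex.exp (Complex.I * (2 * ((t:ℂ) + Complex.I * (e:ℂ)) * w)) /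
      Complex.sinh ((c:ℂ) * ((t:ℂ) + Complex.I * (e:ℂ)))) := by
  have hs := Real.sin_pos_of_pos_of_lt_pi h0 h1
  refine int_of_bound _ ?_ _ (c - 2 * |w.im|) (by linarith) fun t =>
    quot_bound _ _ _ _ _ c t (half_pos hs) (nexp_bd e t w) (sinh_lb c e h0 h1 t)
  exact Continuous.div (by fun_prop) (by fun_prop) (sinh_ne c e h0 h1)

lemma intA0 (c e : ℝ) (h0 : 0 < c * e) (h1 : c * e < Real.pi) (hc : 0 < c) :
    Integrable (fun t : ℝ => 1 / Complex.sinh ((c:ℂ) * ((t:ℂ) + Complex.I * (e:ℂ)))) := by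
  simpa using intA c e h0 h1 0 (by simpa using hc)

lemma valA0 (c e : ℝ) (h0 : 0 < c * e) (h1 : c * e < Real.pi) (hc : 0 < c) :
    ∫ t : ℝ, 1 / Complex.sinh ((c:ℂ) * ((t:ℂ) + Complex.I * (e:ℂ))) =
      - (Real.pi * Complex.I) / c := by
  have hs := Real.sin_pos_of_pos_of_lt_pi h0 h1
  have hcC : (c:ℂ) ≠ 0 := by exact_mod_cast hc.ne'
  set E : ℝ → ℂ := fun t => Complex.exp ((c:ℂ) * ((t:ℂ) + Complex.I * (e:ℂ))) with hE
  have hEim : ∀ t, 0 < (E t).im := by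
    intro t
    simp only [hE, Complex.exp_im]
    have : ((c:ℂ) * ((t:ℂ) + Complex.I * (e:ℂ))).im = c * e := by simp
    rw [this]; positivity
  have hE1 : ∀ t, E t + 1 ≠ 0 := fun t h => by
    have := congrArg Complex.im h
    simp at this; linarith [hEim t]
  have hE2 : ∀ t, E t - 1 ≠ 0 := fun t h => by
    have := congrArg Complex.im h
    simp at this; linarith [hEim t]
  have hEne : ∀ t, E t ≠ 0 := fun t => Complex.exp_ne_zero _
  have hgim : ∀ t, 0 < ((E t - 1) / (E t + 1)).im := by
    intro t
    have hn : 0 < Complex.normSq (E t + 1) := Complex.normSq_pos.2 (hE1 t)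
    rw [Complex.div_im, ← sub_div]
    apply div_pos _ hn
    simp; nlinarith [hEim t]
  have hEd : ∀ t, HasDerivAt E (c * E t) t := by
    intro t
    have h : HasDerivAt (fun t : ℝ => (c:ℂ) * ((t:ℂ) + Complex.I * (e:ℂ))) (c * 1) t :=
      ((Complex.ofRealCLM.hasDerivAt (x := t)).add_const (Complex.I * (e:ℂ))).const_mul (c:ℂ)
    have := h.cexp
    convert this using 1
    simp only [hE]; ring
  have hnE : ∀ t, ‖E t‖ = Real.exp (c * t) := by
    intro t; simp only [hE, Complex.norm_exp]; simp
  have hEbot : Tendsto E atBot (𝓝 0) := by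
    rw [tendsto_zero_iff_norm_tendsto_zero]
    simp_rw [hnE]
    exact Real.tendsto_exp_atBot.comp (tendsto_id.const_mul_atBot hc)
  have hEtop : Tendsto (fun t => (E t)⁻¹) atTop (𝓝 0) := by
    rw [tendsto_zero_iff_norm_tendsto_zero]
    simp_rw [norm_inv, hnE]
    exact (Real.tendsto_exp_atTop.comp (tendsto_id.const_mul_atTop hc)).inv_tendsto_atTop
  have hgbot : Tendsto (fun t => (E t - 1) / (E t + 1)) atBot (𝓝 (-1)) := by
    have := (hEbot.sub_const 1).div (hEbot.add_const 1) (by simp)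
    simpa [Pi.div_def] using this
  have hgtop : Tendsto (fun t => (E t - 1) / (E t + 1)) atTop (𝓝 1) := by
    have := (hEtop.const_sub 1).div (hEtop.const_add 1) (by simp)
    simp only [sub_zero, add_zero, div_one] at this
    refine this.congr fun t => ?_
    have a := hE1 t
    have b := hEne t
    simp only [Pi.div_apply]
    have a' : 1 + (E t)⁻¹ ≠ 0 := by
      rw [show 1 + (E t)⁻¹ = (E t + 1) / E t by field_simp]
      exact div_ne_zero a b
    rw [div_eq_div_iff a' a]; field_simp
  have hd : ∀ t : ℝ, HasDerivAt (fun t => Complex.log ((E t - 1) / (E t + 1)) / c)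
      (1 / Complex.sinh ((c:ℂ) * ((t:ℂ) + Complex.I * (e:ℂ)))) t := by
    intro t
    have h := ((((hEd t).sub_const 1).div ((hEd t).add_const 1) (hE1 t)).clog_real
      (Or.inr (hgim t).ne')).div_const (c:ℂ)
    refine h.congr_deriv (Eq.symm ?_)
    have hsh : Complex.sinh ((c:ℂ) * ((t:ℂ) + Complex.I * (e:ℂ))) = (E t - 1) * (E t + 1) / (2 * E t) := by
      rw [Complex.sinh, Complex.exp_neg]
      change (E t - (E t)⁻¹) / 2 = _
      have := hEne t
      field_simp; ring
    rw [hsh]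
    have a := hE1 t
    have b := hEne t
    have d := hE2 t
    simp only [Pi.div_apply]
    field_simp; ring
  have hlb : Tendsto (fun t => Complex.log ((E t - 1) / (E t + 1)) / c) atBot
      (𝓝 ((Real.pi * Complex.I) / c)) := by
    have h := Complex.tendsto_log_nhdsWithin_im_nonneg_of_re_neg_of_im_zero
      (z := -1) (by simp) (by simp)
    have h2 : Tendsto (fun t => (E t - 1) / (E t + 1)) atBot (𝓝[{ z : ℂ | 0 ≤ z.im }] (-1)) :=
      tendsto_nhdsWithin_iff.2 ⟨hgbot, Eventually.of_forall fun t => (hgim t).le⟩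
    have := (h.comp h2).div_const (c:ℂ)
    simpa [Function.comp_def] using this
  have hlt : Tendsto (fun t => Complex.log ((E t - 1) / (E t + 1)) / c) atTop (𝓝 0) := by
    have := (hgtop.clog (by simp)).div_const (c:ℂ)
    simpa using this
  rw [integral_of_hasDerivAt_of_tendsto hd (intA0 c e h0 h1 hc) hlb hlt]
  ring


lemma sinh_ne' (c : ℝ) (hc : 0 < c) (s : ℂ) (hs : s ≠ 0) (h : |c * s.im| < Real.pi) :
    Complex.sinh ((c:ℂ) * s) ≠ 0 := by
  intro h0
  have h1 := sinh_nsq ((c:ℂ) * s)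
  rw [h0] at h1
  simp only [Complex.re_ofReal_mul, Complex.im_ofReal_mul, norm_zero] at h1
  have h2 : Real.sinh (c * s.re) = 0 := by
    have := sq_nonneg (Real.sin (c * s.im)); nlinarith [sq_nonneg (Real.sinh (c * s.re))]
  have h3 : Real.sin (c * s.im) = 0 := by
    rw [h2] at h1; nlinarith
  rw [Real.sinh_eq_zero] at h2
  rw [abs_lt] at h
  rw [Real.sin_eq_zero_iff_of_lt_of_lt h.1 h.2] at h3
  apply hs
  apply Complex.ext
  · simpa [hc.ne'] using h2
  · simpa [hc.ne'] using h3

lemma diff_dslope (g : ℂ → ℂ) (hg : Differentiable ℂ g) : Differentiable ℂ (dslope g 0) := by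
  rw [← differentiableOn_univ, Complex.differentiableOn_dslope (by simp)]
  exact hg.differentiableOn

lemma sinh_big (x : ℝ) (hx : 1 ≤ |x|) : 1 / 4 * Real.exp |x| ≤ |Real.sinh x| := by
  rw [Real.abs_sinh, Real.sinh_eq]
  generalize |x| = y at hx
  have h1 : Real.exp (-y) ≤ 1 := Real.exp_le_one_iff.2 (by linarith)
  have h2 : 2 ≤ Real.exp y := by linarith [Real.add_one_le_exp y]
  linarith

lemma valA (c e : ℝ) (h0 : 0 < c * e) (h1 : c * e < Real.pi) (hc : 0 < c) (w : ℂ)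
    (hw : 2 * |w.im| < c) :
    (∫ t : ℝ, Complex.exp (Complex.I * (2 * ((t:ℂ) + Complex.I * (e:ℂ)) * w)) /
      Complex.sinh ((c:ℂ) * ((t:ℂ) + Complex.I * (e:ℂ)))) *
      (1 + Complex.exp (2 * (Real.pi / c * w))) = - (2 * Real.pi * Complex.I) / c := by
  have hcC : (c:ℂ) ≠ 0 := by exact_mod_cast hc.ne'
  have he : 0 < e := by by_contra h; push Not at h; nlinarith
  have he2 : e < Real.pi / c := by rw [lt_div_iff₀ hc]; linarith
  set f : ℂ → ℂ := fun s => dslope (fun s => Complex.exp (Complex.I * (2 * s * w))) 0 s /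
    dslope (fun s => Complex.sinh ((c:ℂ) * s)) 0 s with hf
  have hfv : ∀ s : ℂ, s ≠ 0 → f s = Complex.exp (Complex.I * (2 * s * w)) / Complex.sinh ((c:ℂ) * s)
      - 1 / Complex.sinh ((c:ℂ) * s) := by
    intro s hs
    simp only [hf, dslope_of_ne _ hs, slope_def_field]
    simp only [mul_zero, zero_mul, Complex.exp_zero, Complex.sinh_zero, sub_zero]
    rw [div_div_div_cancel_right₀ hs, sub_div]
  have hline : ∀ t y : ℝ, y ≠ 0 → ((t:ℂ) + Complex.I * (y:ℂ)) ≠ 0 := by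
    intro t y hy h
    have := congrArg Complex.im h
    simp at this; exact hy this
  have hq : ∀ t : ℝ, f (t + Complex.I * (e:ℂ)) =
      Complex.exp (Complex.I * (2 * ((t:ℂ) + Complex.I * (e:ℂ)) * w)) /
      Complex.sinh ((c:ℂ) * ((t:ℂ) + Complex.I * (e:ℂ))) -
      1 / Complex.sinh ((c:ℂ) * ((t:ℂ) + Complex.I * (e:ℂ))) := fun t => hfv _ (hline t e he.ne')
  have hp : ∀ t : ℝ, f (t + Complex.I * ((e - Real.pi / c : ℝ):ℂ)) =
      -Complex.exp (2 * (Real.pi / c * w)) * (Complex.exp (Complex.I * (2 * ((t:ℂ) + Complex.I * (e:ℂ)) * w)) /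
      Complex.sinh ((c:ℂ) * ((t:ℂ) + Complex.I * (e:ℂ)))) +
      1 / Complex.sinh ((c:ℂ) * ((t:ℂ) + Complex.I * (e:ℂ))) := by
    intro t
    rw [hfv _ (hline t _ (by linarith))]
    have a1 : (c:ℂ) * ((t:ℂ) + Complex.I * ((e - Real.pi / c : ℝ):ℂ)) =
        (c:ℂ) * ((t:ℂ) + Complex.I * (e:ℂ)) - Real.pi * Complex.I := by
      push_cast; field_simp; ring
    have a2 : Complex.I * (2 * ((t:ℂ) + Complex.I * ((e - Real.pi / c : ℝ):ℂ)) * w) =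
        2 * (Real.pi / c * w) + Complex.I * (2 * ((t:ℂ) + Complex.I * (e:ℂ)) * w) := by
      push_cast
      linear_combination (-2 * Real.pi / c * w) * Complex.I_sq
    rw [a1, a2, Complex.sinh_sub_pi_mul_I, Complex.exp_add]
    ring
  have iA := intA c e h0 h1 w hw
  have iA0 := intA0 c e h0 h1 hc
  have key := shift f (e - Real.pi / c) e (by linarith [div_pos Real.pi_pos hc])
    ((Real.exp (2 * (Real.pi / c) * |w.re|) + 1) / (1 / 4)) (c - 2 * |w.im|) (1 / c) (by linarith)
    ?_ ?_ ?_ ?_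
  · simp_rw [hp, hq] at key
    rw [integral_add (iA.const_mul _) iA0, integral_sub iA iA0, integral_const_mul,
      valA0 c e h0 h1 hc] at key
    linear_combination -key
  · intro s hs
    apply DifferentiableAt.differentiableWithinAt
    refine DifferentiableAt.div (diff_dslope _ (by fun_prop) s) (diff_dslope _ (by fun_prop) s) ?_
    by_cases h : s = 0
    · subst h
      rw [dslope_same]
      have : HasDerivAt (fun s : ℂ => Complex.sinh ((c:ℂ) * s)) (Complex.cosh ((c:ℂ) * 0) * (c * 1)) 0 :=
        ((hasDerivAt_id (0:ℂ)).const_mul (c:ℂ)).csinh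
      rw [this.deriv]
      simpa using hc.ne'
    · rw [dslope_of_ne _ h, slope_def_field]
      refine div_ne_zero ?_ (by simpa using h)
      simp only [mul_zero, Complex.sinh_zero, sub_zero]
      apply sinh_ne' c hc s h
      obtain ⟨hs1, hs2⟩ := hs
      have h3 : c * (Real.pi / c) = Real.pi := by field_simp
      rw [abs_lt]; constructor <;> nlinarith
  · intro t ht y hy
    have ht0 : t ≠ 0 := by
      rintro rfl
      rw [abs_zero] at ht
      linarith [one_div_pos.2 hc]
    have hne : (t:ℂ) + Complex.I * (y:ℂ) ≠ 0 := by
      intro h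
      have := congrArg Complex.re h
      simp at this; exact ht0 this
    rw [hfv _ hne, ← sub_div]
    apply quot_bound _ _ _ _ _ c t (by norm_num)
    · refine (norm_sub_le _ _).trans ?_
      have hy' : |y| ≤ Real.pi / c := by
        rw [abs_le]; constructor <;> linarith [hy.1, hy.2]
      have b1 := nexp_bd y t w
      have b2 : Real.exp (2 * |y| * |w.re|) ≤ Real.exp (2 * (Real.pi / c) * |w.re|) := by
        gcongr
      have b3 : 1 ≤ Real.exp (2 * |w.im| * |t|) := Real.one_le_exp (by positivity)
      rw [norm_one, add_mul, one_mul]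
      have b4 := mul_le_mul_of_nonneg_right b2 (Real.exp_pos (2 * |w.im| * |t|)).le
      linarith
    · have hct : |c * t| = c * |t| := by rw [abs_mul, abs_of_pos hc]
      have := sinh_big (c * t) (by
        rw [hct]; rw [div_le_iff₀ hc] at ht; linarith)
      rw [hct] at this
      refine this.trans ?_
      have := sinh_lb2 ((c:ℂ) * ((t:ℂ) + Complex.I * (y:ℂ)))
      simpa using this
  · simp_rw [hp]; exact (iA.const_mul _).add iA0
  · simp_rw [hq]; exact iA.sub iA0


lemma cosh_ne (c : ℝ) (hc : 0 < c) (w : ℂ) (hw : 2 * |w.im| < c) :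
    Complex.cosh (Real.pi / c * w) ≠ 0 := by
  intro h
  have h1 := congrArg Complex.re h
  rw [show (Real.pi / c * w : ℂ) = ((Real.pi / c : ℝ) : ℂ) * w by push_cast; ring] at h1
  rw [← Complex.re_add_im (((Real.pi / c : ℝ) : ℂ) * w), Complex.cosh_add, Complex.cosh_mul_I,
    Complex.sinh_mul_I] at h1
  simp only [Complex.re_ofReal_mul, Complex.im_ofReal_mul, ← Complex.ofReal_cosh,
    ← Complex.ofReal_sinh, ← Complex.ofReal_cos, ← Complex.ofReal_sin, Complex.add_re,
    Complex.zero_re, Complex.ofReal_re, Complex.I_re, Complex.mul_I_re, Complex.ofReal_im] at h1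
  have h2 : 0 < Real.cos (Real.pi / c * w.im) := by
    apply Real.cos_pos_of_mem_Ioo
    have : |Real.pi / c * w.im| < Real.pi / 2 := by
      rw [abs_mul, abs_of_pos (div_pos Real.pi_pos hc), div_mul_eq_mul_div, div_lt_div_iff₀ hc two_pos]
      nlinarith [Real.pi_pos]
    exact abs_lt.1 this
  have h3 := Real.cosh_pos (Real.pi / c * w.re)
  have := mul_pos h3 h2
  simp at h1
  rcases h1 with h1 | h1 <;> linarith

lemma valF (c e : ℝ) (h0 : 0 < c * e) (h1 : c * e < Real.pi) (hc : 0 < c) (w : ℂ)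
    (hw : 2 * |w.im| < c) :
    ∫ t : ℝ, Complex.sin (2 * ((t:ℂ) + Complex.I * (e:ℂ)) * w) /
      Complex.sinh ((c:ℂ) * ((t:ℂ) + Complex.I * (e:ℂ))) =
      Real.pi / c * (Complex.sinh (Real.pi / c * w) / Complex.cosh (Real.pi / c * w)) := by
  have hcC : (c:ℂ) ≠ 0 := by exact_mod_cast hc.ne'
  have hw' : 2 * |(-w).im| < c := by simpa using hw
  have iA := intA c e h0 h1 w hw
  have iB := intA c e h0 h1 (-w) hw'
  have vA := valA c e h0 h1 hc w hw
  have vB := valA c e h0 h1 hc (-w) hw'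
  have hch := cosh_ne c hc w hw
  have hpt : ∀ t : ℝ, Complex.sin (2 * ((t:ℂ) + Complex.I * (e:ℂ)) * w) /
      Complex.sinh ((c:ℂ) * ((t:ℂ) + Complex.I * (e:ℂ))) = Complex.I / 2 * (
      Complex.exp (Complex.I * (2 * ((t:ℂ) + Complex.I * (e:ℂ)) * (-w))) /
      Complex.sinh ((c:ℂ) * ((t:ℂ) + Complex.I * (e:ℂ))) -
      Complex.exp (Complex.I * (2 * ((t:ℂ) + Complex.I * (e:ℂ)) * w)) /
      Complex.sinh ((c:ℂ) * ((t:ℂ) + Complex.I * (e:ℂ)))) := by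
    intro t
    rw [Complex.sin, mul_comm Complex.I, mul_comm Complex.I (_ * w), mul_neg]
    ring
  simp_rw [hpt]
  rw [integral_const_mul, integral_sub iB iA]
  generalize (∫ t : ℝ, Complex.exp (Complex.I * (2 * ((t:ℂ) + Complex.I * (e:ℂ)) * w)) /
      Complex.sinh ((c:ℂ) * ((t:ℂ) + Complex.I * (e:ℂ)))) = A at *
  generalize (∫ t : ℝ, Complex.exp (Complex.I * (2 * ((t:ℂ) + Complex.I * (e:ℂ)) * (-w))) /
      Complex.sinh ((c:ℂ) * ((t:ℂ) + Complex.I * (e:ℂ)))) = B at *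
  rw [mul_neg, mul_neg] at vB
  generalize (Real.pi / c * w : ℂ) = y at *
  rw [Complex.cosh, Complex.exp_neg] at hch
  rw [Complex.cosh, Complex.sinh, Complex.exp_neg]
  rw [Complex.exp_neg, two_mul, Complex.exp_add] at vB
  rw [two_mul, Complex.exp_add] at vA
  have hE := Complex.exp_ne_zero y
  generalize Complex.exp y = E at *
  have hE2 : 1 + E * E ≠ 0 := by
    intro h
    apply hch
    field_simp
    linear_combination h
  have hE3 : 1 + E ^ 2 ≠ 0 := by rwa [pow_two]
  have hE4 : E ^ 2 + 1 ≠ 0 := by rwa [add_comm]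
  have eA : A = - (2 * Real.pi * Complex.I) / c / (1 + E * E) := by
    rw [eq_div_iff hE2]; exact vA
  have eB : B = - (2 * Real.pi * Complex.I) / c * (E * E) / (1 + E * E) := by
    rw [eq_div_iff hE2, ← vB]; field_simp; ring
  rw [eA, eB]
  have hI := Complex.I_sq
  have hr : (E - E⁻¹) / 2 / ((E + E⁻¹) / 2) = (E * E - 1) / (1 + E * E) := by
    rw [div_div_div_cancel_right₀ two_ne_zero, div_eq_div_iff (by intro h; apply hch; rw [h]; simp) hE2]
    field_simp; ring
  rw [hr]
  field_simp
  linear_combination (-(E ^ 2 - 1)) * hI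

lemma norm_line (e t : ℝ) (he : 0 < e) : e ≤ ‖(t:ℂ) + Complex.I * (e:ℂ)‖ := by
  have := Complex.abs_im_le_norm ((t:ℂ) + Complex.I * (e:ℂ))
  simp only [Complex.add_im, Complex.ofReal_im, Complex.I_mul_im, Complex.ofReal_re, zero_add] at this
  exact (le_abs_self e).trans this

lemma line_ne (e t : ℝ) (he : 0 < e) : (t:ℂ) + Complex.I * (e:ℂ) ≠ 0 :=
  norm_pos_iff.1 (he.trans_le (norm_line e t he))

/-- The auxiliary integral. -/
noncomputable def K (c e : ℝ) (w : ℂ) : ℂ :=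
  ∫ t : ℝ, Complex.cos (2 * ((t:ℂ) + Complex.I * (e:ℂ)) * w) /
      (((t:ℂ) + Complex.I * (e:ℂ)) * Complex.sinh ((c:ℂ) * ((t:ℂ) + Complex.I * (e:ℂ))))

lemma intK (c e : ℝ) (he : 0 < e) (h0 : 0 < c * e) (h1 : c * e < Real.pi) (w : ℂ)
    (hw : 2 * |w.im| < c) :
    Integrable (fun t : ℝ => Complex.cos (2 * ((t:ℂ) + Complex.I * (e:ℂ)) * w) /
      (((t:ℂ) + Complex.I * (e:ℂ)) * Complex.sinh ((c:ℂ) * ((t:ℂ) + Complex.I * (e:ℂ))))) := by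
  have hs := Real.sin_pos_of_pos_of_lt_pi h0 h1
  refine int_of_bound _ ?_ _ (c - 2 * |w.im|) (by linarith) fun t =>
    quot_bound _ _ _ (e * (Real.sin (c * e) / 2)) _ c t (by positivity)
      ((norm_cos_le _).trans (exp_bd e t w)) ?_
  · exact Continuous.div (by fun_prop) (by fun_prop) fun t =>
      mul_ne_zero (line_ne e t he) (sinh_ne c e h0 h1 t)
  · rw [norm_mul, mul_assoc]
    exact mul_le_mul (norm_line e t he) (sinh_lb c e h0 h1 t) (by positivity) (norm_nonneg _)

lemma derivK (c e : ℝ) (he : 0 < e) (hc : 0 < c) (h1 : c * e < Real.pi) (w : ℂ)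
    (hw : 2 * |w.im| < c) :
    HasDerivAt (K c e)
      (-2 * (Real.pi / c * (Complex.sinh (Real.pi / c * w) / Complex.cosh (Real.pi / c * w)))) w := by
  have h0 : 0 < c * e := mul_pos hc he
  have hs := Real.sin_pos_of_pos_of_lt_pi h0 h1
  rw [← valF c e h0 h1 hc w hw, ← integral_const_mul]
  set r := (c - 2 * |w.im|) / 4 with hr
  have hr0 : 0 < r := by rw [hr]; linarith
  refine (hasDerivAt_integral_of_dominated_loc_of_deriv_le (𝕜 := ℂ) (μ := volume)
    (F := fun (w : ℂ) (t : ℝ) => Complex.cos (2 * ((t:ℂ) + Complex.I * (e:ℂ)) * w) /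
      (((t:ℂ) + Complex.I * (e:ℂ)) * Complex.sinh ((c:ℂ) * ((t:ℂ) + Complex.I * (e:ℂ)))))
    (F' := fun (w : ℂ) (t : ℝ) => -2 * (Complex.sin (2 * ((t:ℂ) + Complex.I * (e:ℂ)) * w) /
      Complex.sinh ((c:ℂ) * ((t:ℂ) + Complex.I * (e:ℂ)))))
    (bound := fun t => 2 * (Real.exp (2 * e * (|w.re| + r)) / (Real.sin (c * e) / 2) *
      Real.exp (-(c - (c / 2 + |w.im|)) * |t|)))
    (Metric.ball_mem_nhds w hr0) ?_ (intK c e he h0 h1 w hw) ?_ ?_ ?_ ?_).2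
  · refine Eventually.of_forall fun v => Continuous.aestronglyMeasurable ?_
    exact Continuous.div (by fun_prop) (by fun_prop) fun t =>
      mul_ne_zero (line_ne e t he) (sinh_ne c e h0 h1 t)
  · refine Continuous.aestronglyMeasurable ?_
    exact continuous_const.mul (Continuous.div (by fun_prop) (by fun_prop) (sinh_ne c e h0 h1))
  · refine Eventually.of_forall fun t v hv => ?_
    rw [norm_mul, norm_neg, Complex.norm_ofNat]
    refine mul_le_mul_of_nonneg_left ?_ two_pos.le
    apply quot_bound _ _ _ _ _ c t (half_pos hs) _ (sinh_lb c e h0 h1 t)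
    refine (norm_sin_le _).trans ((exp_bd e t v).trans ?_)
    rw [Metric.mem_ball, dist_eq_norm] at hv
    have i1 := Complex.abs_im_le_norm (v - w)
    have i2 := Complex.abs_re_le_norm (v - w)
    rw [Complex.sub_im] at i1
    rw [Complex.sub_re] at i2
    have j1 : |v.im| ≤ |w.im| + r := by
      have := abs_sub_abs_le_abs_sub v.im w.im; linarith
    have j2 : |v.re| ≤ |w.re| + r := by
      have := abs_sub_abs_le_abs_sub v.re w.re; linarith
    have j3 : 2 * |v.im| ≤ c / 2 + |w.im| := by rw [hr] at j1; linarith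
    rw [abs_of_pos he]
    gcongr
  · refine (Integrable.const_mul ?_ _).const_mul _
    exact int_exp _ (by linarith)
  · refine Eventually.of_forall fun t v _ => ?_
    have hl := line_ne e t he
    have hsn := sinh_ne c e h0 h1 t
    have := (((hasDerivAt_id v).const_mul (2 * ((t:ℂ) + Complex.I * (e:ℂ)))).ccos).div_const
      (((t:ℂ) + Complex.I * (e:ℂ)) * Complex.sinh ((c:ℂ) * ((t:ℂ) + Complex.I * (e:ℂ))))
    refine this.congr_deriv ?_
    simp only [id]
    field_simp

lemma Kconst (c e : ℝ) (he : 0 < e) (hc : 0 < c) (h1 : c * e < Real.pi) (v w : ℂ)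
    (hv : 2 * |v.im| < c) (hw : 2 * |w.im| < c) :
    Complex.exp (K c e v / 2) * Complex.cosh (Real.pi / c * v) =
    Complex.exp (K c e w / 2) * Complex.cosh (Real.pi / c * w) := by
  have hset : {z : ℂ | 2 * |z.im| < c} = Complex.imLm ⁻¹' Set.Ioo (-(c/2)) (c/2) := by
    ext z
    change 2 * |z.im| < c ↔ -(c / 2) < z.im ∧ z.im < c / 2
    rw [← abs_lt]
    constructor <;> intro h <;> linarith
  have hcv : Convex ℝ {z : ℂ | 2 * |z.im| < c} := by
    rw [hset]; exact (convex_Ioo _ _).linear_preimage _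
  have hop : IsOpen {z : ℂ | 2 * |z.im| < c} :=
    isOpen_lt (by fun_prop) continuous_const
  have hd : ∀ z : ℂ, 2 * |z.im| < c → HasDerivAt
      (fun z => Complex.exp (K c e z / 2) * Complex.cosh (Real.pi / c * z)) 0 z := by
    intro z hz
    have a := ((derivK c e he hc h1 z hz).div_const 2).cexp
    have b := ((hasDerivAt_id z).const_mul (Real.pi / c : ℂ)).ccosh
    refine (a.mul b).congr_deriv ?_
    have hch := cosh_ne c hc z hz
    simp only [id]
    rw [div_eq_mul_inv (Complex.sinh _)]
    linear_combination (-(Real.pi / c * Complex.sinh (Real.pi / c * z) *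
      Complex.exp (K c e z / 2))) * (inv_mul_cancel₀ hch)
  refine hop.is_const_of_deriv_eq_zero hcv.isPreconnected
    (fun z hz => (hd z hz).differentiableAt.differentiableWithinAt)
    (fun z hz => (hd z hz).deriv) hv hw

lemma intD (b c e : ℝ) (he : 0 < e) (hb : 0 < b) (hc : 0 < c) (h1 : c * e < Real.pi)
    (h2 : b * e < Real.pi) (α z : ℂ) (hz : 2 * |z.im| + 2 * |α.im| < b + c) :
    Integrable (fun t : ℝ => Complex.cos (2 * ((t:ℂ) + Complex.I * (e:ℂ)) * z) *
          Complex.sin (2 * α * ((t : ℂ) + Complex.I * (e : ℂ))) /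
        (2 * ((t : ℂ) + Complex.I * (e : ℂ)) *
          Complex.sinh ((b : ℂ) * ((t : ℂ) + Complex.I * (e : ℂ))) *
          Complex.sinh ((c:ℂ) * ((t : ℂ) + Complex.I * (e : ℂ))))) := by
  have k1 : 0 < c * e := mul_pos hc he
  have k2 : 0 < b * e := mul_pos hb he
  have hs := Real.sin_pos_of_pos_of_lt_pi k1 h1
  have hs2 := Real.sin_pos_of_pos_of_lt_pi k2 h2
  refine int_of_bound _ ?_ _ ((b + c) - (2 * |z.im| + 2 * |α.im|)) (by linarith) fun t =>
    quot_bound _ _ (Real.exp (2 * |e| * |z.re|) * Real.exp (2 * |e| * |α.re|))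
      (2 * e * (Real.sin (b * e) / 2) * (Real.sin (c * e) / 2)) _ (b + c) t (by positivity) ?_ ?_
  · exact Continuous.div (by fun_prop) (by fun_prop) fun t =>
      mul_ne_zero (mul_ne_zero (mul_ne_zero two_ne_zero (line_ne e t he)) (sinh_ne b e k2 h2 t))
        (sinh_ne c e k1 h1 t)
  · have b1 := (norm_cos_le _).trans (exp_bd e t z)
    have b2 := (norm_sin_le _).trans (exp_bd e t α)
    rw [show 2 * α * ((t : ℂ) + Complex.I * (e : ℂ)) = 2 * ((t : ℂ) + Complex.I * (e : ℂ)) * α by ring,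
      norm_mul, add_mul, Real.exp_add]
    refine (mul_le_mul b1 b2 (norm_nonneg _) (by positivity)).trans (le_of_eq ?_)
    ring
  · have b1 := norm_line e t he
    have b2 := sinh_lb b e k2 h2 t
    have b3 := sinh_lb c e k1 h1 t
    rw [norm_mul, norm_mul, norm_mul, Complex.norm_ofNat, add_mul, Real.exp_add]
    have := mul_le_mul (mul_le_mul (mul_le_mul_of_nonneg_left b1 two_pos.le) b2 (by positivity)
      (by positivity)) b3 (by positivity) (by positivity)
    refine le_trans (le_of_eq ?_) this
    ring

end DF

/-- The functional equation
`D_α(x + ib/2)·cosh(πb(x − α)) = D_α(x − ib/2)·cosh(πb(x + α))`. -/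
theorem Dfun_functional_equation (b ε : ℝ) (hb : 0 < b) (hε0 : 0 < ε)
    (hε : ε < Real.pi * min b b⁻¹) (α x : ℂ)
    (h : |α.im| + |x.im| < 1 / (2 * b)) :
    Dfun b ε α (x + Complex.I * (b : ℂ) / 2) *
        Complex.cosh (((Real.pi * b : ℝ) : ℂ) * (x - α)) =
      Dfun b ε α (x - Complex.I * (b : ℂ) / 2) *
        Complex.cosh (((Real.pi * b : ℝ) : ℂ) * (x + α)) := by
  have hc : 0 < b⁻¹ := inv_pos.2 hb
  have hbc : b * b⁻¹ = 1 := mul_inv_cancel₀ hb.ne'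
  have hm1 : ε < Real.pi * b := hε.trans_le (by gcongr; exact min_le_left _ _)
  have hm2 : ε < Real.pi * b⁻¹ := hε.trans_le (by gcongr; exact min_le_right _ _)
  have hpi := Real.pi_pos
  have h1 : b⁻¹ * ε < Real.pi := by
    calc b⁻¹ * ε < b⁻¹ * (Real.pi * b) := by gcongr
      _ = Real.pi := by field_simp
  have h2 : b * ε < Real.pi := by
    calc b * ε < b * (Real.pi * b⁻¹) := by gcongr
      _ = Real.pi := by field_simp
  have h' : 2 * |α.im| + 2 * |x.im| < b⁻¹ := by
    have : 1 / (2 * b) = b⁻¹ / 2 := by field_simp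
    rw [this] at h; linarith
  have hp : 2 * |(x + α).im| < b⁻¹ := by
    rw [Complex.add_im]; have := abs_add_le x.im α.im; linarith
  have hm : 2 * |(x - α).im| < b⁻¹ := by
    rw [Complex.sub_im]; have := abs_sub x.im α.im; linarith
  have hzp : 2 * |(x + Complex.I * (b : ℂ) / 2).im| + 2 * |α.im| < b + b⁻¹ := by
    have : (x + Complex.I * (b : ℂ) / 2).im = x.im + b / 2 := by simp
    rw [this]; have := abs_add_le x.im (b / 2); rw [abs_of_pos (half_pos hb)] at this; linarith
  have hzm : 2 * |(x - Complex.I * (b : ℂ) / 2).im| + 2 * |α.im| < b + b⁻¹ := by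
    have : (x - Complex.I * (b : ℂ) / 2).im = x.im - b / 2 := by simp
    rw [this]; have := abs_sub x.im (b / 2); rw [abs_of_pos (half_pos hb)] at this; linarith
  have k0 : 0 < b⁻¹ * ε := mul_pos hc hε0
  have iP := DF.intD b b⁻¹ ε hε0 hb hc h1 h2 α _ hzp
  have iM := DF.intD b b⁻¹ ε hε0 hb hc h1 h2 α _ hzm
  have jP := DF.intK b⁻¹ ε hε0 k0 h1 _ hp
  have jM := DF.intK b⁻¹ ε hε0 k0 h1 _ hm
  have hK := DF.Kconst b⁻¹ ε hε0 hc h1 _ _ hm hp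
  have hbC : (b:ℂ) ≠ 0 := by exact_mod_cast hb.ne'
  have hdiv : ∀ s : ℂ, s / (b:ℂ) = ((b⁻¹ : ℝ) : ℂ) * s := by
    intro s; push_cast; field_simp
  have hpc : (Real.pi : ℂ) / ((b⁻¹ : ℝ) : ℂ) = ((Real.pi * b : ℝ) : ℂ) := by
    push_cast; field_simp
  rw [hpc] at hK
  have key : (∫ t : ℝ, Complex.cos (2 * ((t:ℂ) + Complex.I * (ε:ℂ)) * (x + Complex.I * (b : ℂ) / 2)) *
          Complex.sin (2 * α * ((t : ℂ) + Complex.I * (ε : ℂ))) /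
        (2 * ((t : ℂ) + Complex.I * (ε : ℂ)) *
          Complex.sinh ((b : ℂ) * ((t : ℂ) + Complex.I * (ε : ℂ))) *
          Complex.sinh (((b⁻¹ : ℝ):ℂ) * ((t : ℂ) + Complex.I * (ε : ℂ))))) -
      (∫ t : ℝ, Complex.cos (2 * ((t:ℂ) + Complex.I * (ε:ℂ)) * (x - Complex.I * (b : ℂ) / 2)) *
          Complex.sin (2 * α * ((t : ℂ) + Complex.I * (ε : ℂ))) /
        (2 * ((t : ℂ) + Complex.I * (ε : ℂ)) *
          Complex.sinh ((b : ℂ) * ((t : ℂ) + Complex.I * (ε : ℂ))) *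
          Complex.sinh (((b⁻¹ : ℝ):ℂ) * ((t : ℂ) + Complex.I * (ε : ℂ))))) =
      -Complex.I / 2 * (DF.K b⁻¹ ε (x - α) - DF.K b⁻¹ ε (x + α)) := by
    rw [← integral_sub iP iM, DF.K, DF.K, ← integral_sub jM jP, ← integral_const_mul]
    congr 1
    funext t
    have n1 := DF.line_ne ε t hε0
    have n2 := DF.sinh_ne b ε (mul_pos hb hε0) h2 t
    have n3 := DF.sinh_ne b⁻¹ ε k0 h1 t
    generalize (t : ℂ) + Complex.I * (ε : ℂ) = s at *
    rw [show 2 * s * (x + Complex.I * (b : ℂ) / 2) = 2 * s * x + (b * s) * Complex.I by ring,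
      show 2 * s * (x - Complex.I * (b : ℂ) / 2) = 2 * s * x - (b * s) * Complex.I by ring,
      show 2 * s * (x + α) = 2 * s * x + 2 * α * s by ring,
      show 2 * s * (x - α) = 2 * s * x - 2 * α * s by ring]
    rw [Complex.cos_add, Complex.cos_sub, Complex.cos_add, Complex.cos_sub, Complex.cos_mul_I,
      Complex.sin_mul_I]
    generalize Complex.sinh ((b:ℂ) * s) = p at *
    generalize Complex.sinh (((b⁻¹ : ℝ) : ℂ) * s) = q at *
    field_simp
    ring
  unfold Dfun
  simp_rw [hdiv]
  rw [sub_eq_iff_eq_add] at key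
  rw [key]
  generalize (∫ t : ℝ, Complex.cos (2 * ((t:ℂ) + Complex.I * (ε:ℂ)) * (x - Complex.I * (b : ℂ) / 2)) *
          Complex.sin (2 * α * ((t : ℂ) + Complex.I * (ε : ℂ))) /
        (2 * ((t : ℂ) + Complex.I * (ε : ℂ)) *
          Complex.sinh ((b : ℂ) * ((t : ℂ) + Complex.I * (ε : ℂ))) *
          Complex.sinh (((b⁻¹ : ℝ):ℂ) * ((t : ℂ) + Complex.I * (ε : ℂ))))) = M
  have hexp : Complex.I * (-Complex.I / 2 * (DF.K b⁻¹ ε (x - α) - DF.K b⁻¹ ε (x + α)) + M) =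
      Complex.I * M + DF.K b⁻¹ ε (x - α) / 2 - DF.K b⁻¹ ε (x + α) / 2 := by
    linear_combination (-(DF.K b⁻¹ ε (x - α) - DF.K b⁻¹ ε (x + α)) / 2) * Complex.I_sq
  rw [hexp, Complex.exp_sub, Complex.exp_add]
  have hne := Complex.exp_ne_zero (DF.K b⁻¹ ε (x + α) / 2)
  rw [div_mul_eq_mul_div, div_eq_iff hne]
  linear_combination Complex.exp (Complex.I * M) * hK
end

section
/- For every α ∈ ℂ with |Im α| < Q/2, the function D_α has the asymptotics: D_α(x)·exp(2πiαx) → 1 as x → +∞ along the real axis, and D_α(x)·exp(−2πiαx) → 1 as x → −∞ along the real axis. -/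
open MeasureTheory Filter

noncomputable def fF (b : ℝ) (α w : ℂ) : ℂ :=
  Complex.sin (2 * α * w) / (2 * w * Complex.sinh ((b : ℂ) * w) * Complex.sinh (w / (b : ℂ)))

lemma aux_sinh_ge (z : ℂ) : |Real.sinh z.re| ≤ ‖Complex.sinh z‖ := by
  have h := abs_norm_sub_norm_le (Complex.exp z) (Complex.exp (-z))
  rw [Complex.norm_exp, Complex.norm_exp, Complex.neg_re] at h
  rw [Real.sinh_eq, Complex.sinh, norm_div, abs_div]
  simp only [Complex.norm_ofNat, Nat.abs_ofNat]
  gcongr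

lemma aux_sin_le (z : ℂ) : ‖Complex.sin z‖ ≤ Real.exp |z.im| := by
  rw [Complex.sin, norm_div, norm_mul, Complex.norm_I]
  have h := norm_sub_le (Complex.exp (-z * Complex.I)) (Complex.exp (z * Complex.I))
  rw [Complex.norm_exp, Complex.norm_exp] at h
  simp only [Complex.mul_re, Complex.neg_re, Complex.neg_im, Complex.I_re, Complex.I_im] at h
  have h1 : Real.exp (-z.re * 0 - -z.im * 1) ≤ Real.exp |z.im| :=
    Real.exp_le_exp.2 (by have := le_abs_self z.im; linarith)
  have h2 : Real.exp (z.re * 0 - z.im * 1) ≤ Real.exp |z.im| :=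
    Real.exp_le_exp.2 (by have := neg_abs_le z.im; linarith)
  rw [Complex.norm_ofNat]
  linarith

lemma aux_sinh_ne (z : ℂ) (h0 : z ≠ 0) (h : |z.im| < Real.pi) : Complex.sinh z ≠ 0 := by
  intro hz
  have h1 := aux_sinh_ge z
  rw [hz, norm_zero] at h1
  have h2 : z.re = 0 := by
    have : Real.sinh z.re = 0 := abs_eq_zero.1 (le_antisymm h1 (abs_nonneg _))
    simpa using this
  have h3 : z = (z.im : ℂ) * Complex.I := by
    apply Complex.ext <;> simp [h2]
  rw [h3, Complex.sinh_mul_I] at hz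
  have h4 : Real.sin z.im = 0 := by
    have : Complex.sin (z.im : ℂ) = 0 := by simpa using hz
    exact_mod_cast this
  rw [abs_lt] at h
  have h5 := (Real.sin_eq_zero_iff_of_lt_of_lt h.1 h.2).1 h4
  exact h0 (Complex.ext h2 h5)

lemma aux_sinh_low (a t : ℝ) (ha : 0 < a) (ht : 1 ≤ |t|) :
    (1 - Real.exp (-(2 * a))) / 2 * Real.exp (a * |t|) ≤ |Real.sinh (a * t)| := by
  rw [Real.abs_sinh, abs_mul, abs_of_pos ha, Real.sinh_eq]
  have : Real.exp (-(a * |t|)) ≤ Real.exp (-(2 * a)) * Real.exp (a * |t|) := by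
    rw [← Real.exp_add]
    apply Real.exp_le_exp.2
    nlinarith
  linarith

lemma aux_bound (b ε : ℝ) (hb : 0 < b) (α : ℂ) (hα : |α.im| < (b + b⁻¹) / 2) :
    ∃ C : ℝ, 0 < C ∧ ∀ w : ℂ, 1 ≤ |w.re| → |w.im| ≤ ε → ‖fF b α w‖ ≤ C * (1 + w.re ^ 2)⁻¹ := by
  set δ := b + b⁻¹ - 2 * |α.im| with hδ
  have hδ0 : 0 < δ := by linarith
  have hb' : 0 < b⁻¹ := inv_pos.2 hb
  set c1 := (1 - Real.exp (-(2 * b))) / 2 with hc1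
  set c2 := (1 - Real.exp (-(2 * b⁻¹))) / 2 with hc2
  have hc1p : 0 < c1 := by
    have : Real.exp (-(2 * b)) < 1 := by simpa using by positivity
    linarith
  have hc2p : 0 < c2 := by
    have : Real.exp (-(2 * b⁻¹)) < 1 := by simpa using by positivity
    linarith
  set A := Real.exp (2 * |α.re| * ε) / (2 * c1 * c2) with hA
  have hAp : 0 < A := by positivity
  refine ⟨A * (4 / δ ^ 2), by positivity, ?_⟩
  intro w h1 h2
  have hwn : |w.re| ≤ ‖w‖ := Complex.abs_re_le_norm w
  set t := w.re with ht
  have e1 : ‖Complex.sin (2 * α * w)‖ ≤ Real.exp (2 * |α.re| * ε) * Real.exp (2 * |α.im| * |t|) := by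
    refine (aux_sin_le _).trans ?_
    rw [← Real.exp_add]
    apply Real.exp_le_exp.2
    have : (2 * α * w).im = 2 * (α.re * w.im + α.im * w.re) := by
      simp [Complex.mul_im]; ring
    rw [this, abs_mul, abs_two]
    have := abs_add_le (α.re * w.im) (α.im * w.re)
    rw [abs_mul, abs_mul] at this
    have h3 := mul_le_mul_of_nonneg_left h2 (abs_nonneg α.re)
    nlinarith
  have e2 : c1 * Real.exp (b * |t|) ≤ ‖Complex.sinh ((b : ℂ) * w)‖ := by
    refine (aux_sinh_low b t hb h1).trans ?_
    have := aux_sinh_ge ((b : ℂ) * w)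
    rwa [Complex.re_ofReal_mul] at this
  have e3 : c2 * Real.exp (b⁻¹ * |t|) ≤ ‖Complex.sinh (w / (b : ℂ))‖ := by
    refine (aux_sinh_low b⁻¹ t hb' h1).trans ?_
    have := aux_sinh_ge (w / (b : ℂ))
    rwa [Complex.div_ofReal_re, div_eq_inv_mul] at this
  have e4 : ‖fF b α w‖ ≤ (Real.exp (2 * |α.re| * ε) * Real.exp (2 * |α.im| * |t|)) /
      (2 * 1 * (c1 * Real.exp (b * |t|)) * (c2 * Real.exp (b⁻¹ * |t|))) := by
    rw [fF, norm_div, norm_mul, norm_mul, norm_mul, Complex.norm_ofNat]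
    gcongr
    linarith
  have e5 : (Real.exp (2 * |α.re| * ε) * Real.exp (2 * |α.im| * |t|)) /
      (2 * 1 * (c1 * Real.exp (b * |t|)) * (c2 * Real.exp (b⁻¹ * |t|))) =
      A * (Real.exp (δ * |t|))⁻¹ := by
    have : Real.exp (δ * |t|) = Real.exp (b * |t|) * Real.exp (b⁻¹ * |t|) /
        Real.exp (2 * |α.im| * |t|) := by
      rw [← Real.exp_add, ← Real.exp_sub, hδ]; congr 1; ring
    rw [this, hA]
    field_simp
  rw [e5] at e4
  refine e4.trans ?_
  rw [mul_assoc]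
  apply mul_le_mul_of_nonneg_left _ hAp.le
  have h6 : δ ^ 2 / 4 * (1 + t ^ 2) ≤ Real.exp (δ * |t|) := by
    have := Real.quadratic_le_exp_of_nonneg (x := δ * |t|) (by positivity)
    have h7 : 1 ≤ t ^ 2 := by rw [← sq_abs]; nlinarith
    have h8 : (δ * |t|) ^ 2 = δ ^ 2 * t ^ 2 := by rw [mul_pow, sq_abs]
    have h9 : 0 ≤ δ * |t| := by positivity
    have h10 : 0 < δ ^ 2 := by positivity
    nlinarith
  calc (Real.exp (δ * |t|))⁻¹ ≤ (δ ^ 2 / 4 * (1 + t ^ 2))⁻¹ := by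
        apply inv_anti₀ (by positivity) h6
    _ = 4 / δ ^ 2 * (1 + t ^ 2)⁻¹ := by
        rw [mul_inv, inv_div]

lemma aux_den_ne (b ε : ℝ) (hb : 0 < b)
    (hε : ε < Real.pi * min b b⁻¹) (w : ℂ) (h0 : w ≠ 0) (hw : |w.im| ≤ ε) :
    Complex.sinh ((b : ℂ) * w) ≠ 0 ∧ Complex.sinh (w / (b : ℂ)) ≠ 0 := by
  have hbc : (b : ℂ) ≠ 0 := by exact_mod_cast hb.ne'
  have hp := Real.pi_pos
  constructor
  · apply aux_sinh_ne _ (mul_ne_zero hbc h0)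
    have : ε < Real.pi * b⁻¹ := hε.trans_le (by gcongr; exact min_le_right _ _)
    rw [Complex.im_ofReal_mul, abs_mul, abs_of_pos hb]
    calc b * |w.im| < b * (Real.pi * b⁻¹) := by gcongr; linarith
      _ = Real.pi := by field_simp
  · apply aux_sinh_ne _ (div_ne_zero h0 hbc)
    have : ε < Real.pi * b := hε.trans_le (by gcongr; exact min_le_left _ _)
    rw [Complex.div_ofReal_im, abs_div, abs_of_pos hb, div_lt_iff₀ hb]
    linarith

lemma aux_line_ne (y : ℝ) (hy : y ≠ 0) (t : ℝ) : (t : ℂ) + y * Complex.I ≠ 0 := by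
  intro h
  apply hy
  simpa using congrArg Complex.im h

lemma aux_integrable (b ε : ℝ) (hb : 0 < b)
    (hε : ε < Real.pi * min b b⁻¹) (α : ℂ) (hα : |α.im| < (b + b⁻¹) / 2)
    (y : ℝ) (hy : y ≠ 0) (hyε : |y| ≤ ε) :
    Integrable (fun t : ℝ => fF b α ((t : ℂ) + y * Complex.I)) := by
  obtain ⟨C, hC, hbd⟩ := aux_bound b ε hb α hα
  have hcont : Continuous (fun t : ℝ => fF b α ((t : ℂ) + y * Complex.I)) := by
    unfold fF
    refine Continuous.div (by fun_prop) (by fun_prop) ?_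
    intro t
    have h0 := aux_line_ne y hy t
    obtain ⟨h1, h2⟩ := aux_den_ne b ε hb hε _ h0 (by simpa using hyε)
    exact mul_ne_zero (mul_ne_zero (mul_ne_zero two_ne_zero h0) h1) h2
  refine hcont.locallyIntegrable.integrable_of_isBigO_cocompact (g := fun t : ℝ => (1 + t ^ 2)⁻¹)
    ?_ (integrable_inv_one_add_sq.integrableAtFilter _)
  refine Asymptotics.IsBigO.of_bound C ?_
  have : ∀ᶠ t : ℝ in cocompact ℝ, 1 ≤ ‖t‖ :=
    (tendsto_norm_cocompact_atTop (E := ℝ)).eventually_ge_atTop 1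
  filter_upwards [this] with t ht
  have := hbd ((t : ℂ) + y * Complex.I) (by simpa using ht) (by simpa using hyε)
  have h2 : ‖(1 + t ^ 2)⁻¹‖ = (1 + t ^ 2)⁻¹ := by
    rw [Real.norm_of_nonneg (by positivity)]
  rw [h2]
  simpa using this

lemma aux_dslope (g : ℂ → ℂ) (w : ℂ) (hw : w ≠ 0) : dslope g 0 w = (g w - g 0) / w := by
  rw [dslope_of_ne _ hw, slope_def_field, sub_zero]

noncomputable def psiF (b : ℝ) (α w : ℂ) : ℂ :=
  dslope (fun w => Complex.sin (2 * α * w)) 0 w /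
    (2 * dslope (fun w => Complex.sinh ((b : ℂ) * w)) 0 w *
      dslope (fun w => Complex.sinh (w / (b : ℂ))) 0 w)

lemma psiF_of_ne (b : ℝ) (α w : ℂ) (hw : w ≠ 0) : psiF b α w = w ^ 2 * fF b α w := by
  rw [psiF, aux_dslope _ _ hw, aux_dslope _ _ hw, aux_dslope _ _ hw, fF]
  simp only [mul_zero, Complex.sin_zero, Complex.sinh_zero, zero_div, sub_zero]
  by_cases h1 : Complex.sinh ((b : ℂ) * w) = 0
  · simp [h1]
  by_cases h2 : Complex.sinh (w / (b : ℂ)) = 0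
  · simp [h2]
  field_simp

lemma ds_sinh_zero (b : ℝ) : dslope (fun w => Complex.sinh ((b : ℂ) * w)) 0 0 = b := by
  rw [dslope_same]
  have : HasDerivAt (fun w : ℂ => Complex.sinh ((b : ℂ) * w)) (Complex.cosh ((b : ℂ) * 0) * ((b : ℂ) * 1)) 0 :=
    ((hasDerivAt_id (0 : ℂ)).const_mul (b : ℂ)).csinh
  rw [this.deriv]; simp

lemma ds_sinh_zero' (b : ℝ) : dslope (fun w => Complex.sinh (w / (b : ℂ))) 0 0 = (b : ℂ)⁻¹ := by
  rw [dslope_same]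
  have : HasDerivAt (fun w : ℂ => Complex.sinh (w / (b : ℂ))) (Complex.cosh (0 / (b : ℂ)) * (1 / (b : ℂ))) 0 :=
    ((hasDerivAt_id (0 : ℂ)).div_const (b : ℂ)).csinh
  rw [this.deriv]; simp

lemma ds_sin_zero (α : ℂ) : dslope (fun w => Complex.sin (2 * α * w)) 0 0 = 2 * α := by
  rw [dslope_same]
  have : HasDerivAt (fun w : ℂ => Complex.sin (2 * α * w)) (Complex.cos (2 * α * 0) * (2 * α * 1)) 0 :=
    ((hasDerivAt_id (0 : ℂ)).const_mul (2 * α)).csin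
  rw [this.deriv]; simp

lemma psiF_zero (b : ℝ) (hb : 0 < b) (α : ℂ) : psiF b α 0 = α := by
  have hbc : (b : ℂ) ≠ 0 := by exact_mod_cast hb.ne'
  rw [psiF, ds_sinh_zero, ds_sinh_zero', ds_sin_zero]
  field_simp

lemma psiF_neg (b : ℝ) (α w : ℂ) : psiF b α (-w) = psiF b α w := by
  by_cases hw : w = 0
  · simp [hw]
  rw [psiF_of_ne _ _ _ hw, psiF_of_ne _ _ _ (neg_ne_zero.2 hw), fF, fF]
  simp only [mul_neg, neg_div, Complex.sin_neg, Complex.sinh_neg, neg_mul, neg_neg, div_neg, neg_sq]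

lemma deriv_psiF_zero (b : ℝ) (α : ℂ) : deriv (psiF b α) 0 = 0 := by
  have h1 : (fun w => psiF b α (-w)) = psiF b α := funext (psiF_neg b α)
  have h2 := deriv_comp_neg (f := psiF b α) (x := (0 : ℂ))
  rw [h1, neg_zero] at h2
  exact self_eq_neg.1 h2

def stripS (R : ℝ) : Set ℂ := {w : ℂ | |w.im| < R}

lemma isOpen_stripS (R : ℝ) : IsOpen (stripS R) :=
  isOpen_lt (Complex.continuous_im.abs) continuous_const

lemma psiF_diff (b : ℝ) (hb : 0 < b) (α : ℂ) :
    DifferentiableOn ℂ (psiF b α) (stripS (Real.pi * min b b⁻¹)) := by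
  have hbc : (b : ℂ) ≠ 0 := by exact_mod_cast hb.ne'
  have hp : 0 < Real.pi * min b b⁻¹ := by have := Real.pi_pos; positivity
  have hn : stripS (Real.pi * min b b⁻¹) ∈ nhds (0 : ℂ) :=
    (isOpen_stripS _).mem_nhds (by simpa [stripS] using hp)
  unfold psiF
  refine DifferentiableOn.div ?_ ?_ ?_
  · exact (Complex.differentiableOn_dslope hn).2 (by fun_prop)
  · refine DifferentiableOn.mul (DifferentiableOn.mul (by fun_prop) ?_) ?_
    · exact (Complex.differentiableOn_dslope hn).2 (by fun_prop)
    · exact (Complex.differentiableOn_dslope hn).2 (by fun_prop)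
  · intro w hw
    by_cases h0 : w = 0
    · rw [h0, ds_sinh_zero, ds_sinh_zero']
      simp [hbc]
    · have hw' : |w.im| < Real.pi * min b b⁻¹ := hw
      obtain ⟨h1, h2⟩ := aux_den_ne b |w.im| hb hw' w h0 le_rfl
      rw [aux_dslope _ _ h0, aux_dslope _ _ h0]
      simp [h0, h1, h2]

lemma aux_h (b : ℝ) (hb : 0 < b) (α : ℂ) (x : ℝ) :
    ∃ h : ℂ → ℂ, DifferentiableOn ℂ h (stripS (Real.pi * min b b⁻¹)) ∧
      ∀ w : ℂ, w ≠ 0 → h w = Complex.exp (-2 * Complex.I * x * w) * fF b α w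
        - α * (w ^ 2)⁻¹ + 2 * Complex.I * x * α * w⁻¹ := by
  have hp : 0 < Real.pi * min b b⁻¹ := by have := Real.pi_pos; positivity
  have hn : stripS (Real.pi * min b b⁻¹) ∈ nhds (0 : ℂ) :=
    (isOpen_stripS _).mem_nhds (by simpa [stripS] using hp)
  have hψ := psiF_diff b hb α
  set φ : ℂ → ℂ := fun w => Complex.exp (-2 * Complex.I * x * w) * psiF b α w with hφ
  have hφd : DifferentiableOn ℂ φ (stripS (Real.pi * min b b⁻¹)) :=
    DifferentiableOn.mul (by fun_prop) hψ
  have hφ0 : φ 0 = α := by simp [hφ, psiF_zero b hb α]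
  have hφ' : deriv φ 0 = -2 * Complex.I * x * α := by
    have h1 : HasDerivAt (psiF b α) 0 0 := by
      have := (hψ.differentiableAt hn).hasDerivAt
      rwa [deriv_psiF_zero] at this
    have h2 : HasDerivAt (fun w : ℂ => Complex.exp (-2 * Complex.I * x * w))
        (Complex.exp (-2 * Complex.I * x * 0) * (-2 * Complex.I * x * 1)) 0 :=
      ((hasDerivAt_id (0 : ℂ)).const_mul (-2 * Complex.I * (x : ℂ))).cexp
    have h3 := (h2.mul h1).deriv
    have h4 : deriv φ 0 = _ := h3
    rw [h4, psiF_zero b hb α]; simp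
  refine ⟨dslope (dslope φ 0) 0, (Complex.differentiableOn_dslope hn).2
    ((Complex.differentiableOn_dslope hn).2 hφd), ?_⟩
  intro w hw
  rw [aux_dslope _ _ hw, aux_dslope _ _ hw, dslope_same, hφ', hφ0, hφ]
  simp only
  rw [psiF_of_ne _ _ _ hw]
  field_simp
  ring

lemma aux_cauchy_int (y : ℝ) (hy : 0 < y) :
    Integrable (fun t : ℝ => (t ^ 2 + y ^ 2)⁻¹) ∧ ∫ t : ℝ, (t ^ 2 + y ^ 2)⁻¹ = Real.pi / y := by
  have he : (fun t : ℝ => (t ^ 2 + y ^ 2)⁻¹) =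
      fun t : ℝ => (y ^ 2)⁻¹ * (fun s : ℝ => (1 + s ^ 2)⁻¹) (y⁻¹ * t) := by
    funext t
    simp only
    rw [← mul_inv]
    congr 1
    field_simp
    ring
  rw [he]
  constructor
  · exact (integrable_inv_one_add_sq.comp_mul_left' (inv_ne_zero hy.ne')).const_mul _
  · rw [integral_const_mul, Measure.integral_comp_inv_mul_left (fun s : ℝ => (1 + s ^ 2)⁻¹) y, integral_univ_inv_one_add_sq,
      abs_of_pos hy, smul_eq_mul]
    field_simp

lemma aux_w_tendsto (y : ℝ) :
    Tendsto (fun t : ℝ => -((t : ℂ) + y * Complex.I)⁻¹) (cocompact ℝ) (nhds 0) := by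
  rw [← neg_zero]
  refine Tendsto.neg ?_
  rw [tendsto_zero_iff_norm_tendsto_zero]
  refine squeeze_zero' (Eventually.of_forall fun t => norm_nonneg _) ?_
    (tendsto_inv_atTop_zero.comp (tendsto_norm_cocompact_atTop (E := ℝ)))
  have : ∀ᶠ t : ℝ in cocompact ℝ, 1 ≤ ‖t‖ :=
    (tendsto_norm_cocompact_atTop (E := ℝ)).eventually_ge_atTop 1
  filter_upwards [this] with t ht
  rw [norm_inv]
  simp only [Function.comp]
  apply inv_anti₀ (by linarith)
  have := Complex.abs_re_le_norm ((t : ℂ) + y * Complex.I)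
  simpa using this

lemma aux_sq_int (y : ℝ) (hy : y ≠ 0) :
    Integrable (fun t : ℝ => (((t : ℂ) + y * Complex.I) ^ 2)⁻¹) ∧
      ∫ t : ℝ, (((t : ℂ) + y * Complex.I) ^ 2)⁻¹ = 0 := by
  have hi : Integrable (fun t : ℝ => (((t : ℂ) + y * Complex.I) ^ 2)⁻¹) := by
    refine (aux_cauchy_int |y| (abs_pos.2 hy)).1.mono' ?_ ?_
    · refine (Continuous.inv₀ (by fun_prop) ?_).aestronglyMeasurable
      intro t
      exact pow_ne_zero 2 (aux_line_ne y hy t)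
    · refine Eventually.of_forall fun t => le_of_eq ?_
      rw [norm_inv, norm_pow, ← Complex.normSq_eq_norm_sq, Complex.normSq_add_mul_I, sq_abs]
  refine ⟨hi, ?_⟩
  have hd : ∀ t : ℝ, HasDerivAt (fun t : ℝ => -((t : ℂ) + y * Complex.I)⁻¹)
      ((((t : ℂ) + y * Complex.I) ^ 2)⁻¹) t := by
    intro t
    have h1 : HasDerivAt (fun t : ℝ => (t : ℂ) + y * Complex.I) 1 t :=
      (Complex.ofRealCLM.hasDerivAt (x := t)).add_const _
    have h2 := (h1.fun_inv (aux_line_ne y hy t)).neg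
    have h3 : -(-1 / ((t : ℂ) + y * Complex.I) ^ 2) = (((t : ℂ) + y * Complex.I) ^ 2)⁻¹ := by
      rw [neg_div, neg_neg, one_div]
    rw [← h3]
    exact h2
  have h := integral_of_hasDerivAt_of_tendsto hd hi
    ((aux_w_tendsto y).mono_left (by rw [cocompact_eq_atBot_atTop]; exact le_sup_left))
    ((aux_w_tendsto y).mono_left (by rw [cocompact_eq_atBot_atTop]; exact le_sup_right))
  rw [h, sub_zero]

lemma aux_r (ε : ℝ) (hε : 0 < ε) :
    Integrable (fun t : ℝ => ((t : ℂ) + (-ε : ℝ) * Complex.I)⁻¹ - ((t : ℂ) + ε * Complex.I)⁻¹) ∧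
      ∫ t : ℝ, (((t : ℂ) + (-ε : ℝ) * Complex.I)⁻¹ - ((t : ℂ) + ε * Complex.I)⁻¹)
        = 2 * Real.pi * Complex.I := by
  have he : (fun t : ℝ => ((t : ℂ) + (-ε : ℝ) * Complex.I)⁻¹ - ((t : ℂ) + ε * Complex.I)⁻¹) =
      fun t : ℝ => (2 * Complex.I * ε) * (((t ^ 2 + ε ^ 2)⁻¹ : ℝ) : ℂ) := by
    funext t
    have h1 := aux_line_ne (-ε) (by linarith) t
    have h2 := aux_line_ne ε hε.ne' t
    have h3 : (t : ℂ) ^ 2 + (ε : ℂ) ^ 2 = ((t : ℂ) + (-ε : ℝ) * Complex.I) * ((t : ℂ) + ε * Complex.I) := by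
      push_cast
      linear_combination ((ε : ℂ) ^ 2) * Complex.I_sq
    rw [Complex.ofReal_inv]
    push_cast at h3 h1 ⊢
    rw [neg_mul, ← sub_eq_add_neg] at h3 h1 ⊢
    rw [h3]
    field_simp
    ring
  rw [he]
  obtain ⟨h1, h2⟩ := aux_cauchy_int ε hε
  refine ⟨h1.ofReal.const_mul _, ?_⟩
  rw [integral_const_mul, integral_complex_ofReal, h2]
  have : (ε : ℂ) ≠ 0 := by exact_mod_cast hε.ne'
  push_cast
  field_simp

lemma aux_E_norm (x : ℝ) (w : ℂ) :
    ‖Complex.exp (-2 * Complex.I * x * w)‖ = Real.exp (2 * x * w.im) := by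
  rw [Complex.norm_exp]
  congr 1
  simp [Complex.mul_re, Complex.mul_im]

lemma aux_E_int (b ε : ℝ) (hb : 0 < b)
    (hε : ε < Real.pi * min b b⁻¹) (α : ℂ) (hα : |α.im| < (b + b⁻¹) / 2)
    (y : ℝ) (hy : y ≠ 0) (hyε : |y| ≤ ε) (x : ℝ) :
    Integrable (fun t : ℝ => Complex.exp (-2 * Complex.I * x * ((t : ℂ) + y * Complex.I)) *
      fF b α ((t : ℂ) + y * Complex.I)) := by
  refine (aux_integrable b ε hb hε α hα y hy hyε).bdd_mul (c := Real.exp (2 * x * y)) ?_ ?_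
  · exact Continuous.aestronglyMeasurable (by fun_prop)
  · refine Eventually.of_forall fun t => le_of_eq ?_
    rw [aux_E_norm]
    simp

lemma aux_E_bound (b : ℝ) (α : ℂ) (y x : ℝ) :
    ‖∫ t : ℝ, Complex.exp (-2 * Complex.I * x * ((t : ℂ) + y * Complex.I)) *
      fF b α ((t : ℂ) + y * Complex.I)‖ ≤
      Real.exp (2 * x * y) * ∫ t : ℝ, ‖fF b α ((t : ℂ) + y * Complex.I)‖ := by
  rw [← integral_const_mul]
  refine (norm_integral_le_integral_norm _).trans (le_of_eq ?_)
  congr 1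
  funext t
  rw [norm_mul, aux_E_norm]
  simp

lemma aux_lin {f1 f2 g1 g2 r : ℝ → ℂ} (hf1 : Integrable f1) (hf2 : Integrable f2)
    (hg1 : Integrable g1) (hg2 : Integrable g2) (hr : Integrable r) (c d : ℂ) :
    ∫ t, ((f1 t - f2 t) - c * (g1 t - g2 t) + d * r t) =
      (((∫ t, f1 t) - ∫ t, f2 t) - c * ((∫ t, g1 t) - ∫ t, g2 t)) + d * ∫ t, r t := by
  have h1 : Integrable (fun t => f1 t - f2 t) := hf1.sub hf2
  have h2 : Integrable (fun t => c * (g1 t - g2 t)) := (hg1.sub hg2).const_mul c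
  have h3 : Integrable (fun t => (f1 t - f2 t) - c * (g1 t - g2 t)) := h1.sub h2
  rw [integral_add h3 (hr.const_mul d), integral_sub h1 h2, integral_sub hf1 hf2,
    integral_const_mul, integral_const_mul, integral_sub hg1 hg2]

lemma aux_shift (b ε : ℝ) (hb : 0 < b) (hε0 : 0 < ε)
    (hε : ε < Real.pi * min b b⁻¹) (α : ℂ) (hα : |α.im| < (b + b⁻¹) / 2) (x : ℝ) :
    ∫ t : ℝ, Complex.exp (-2 * Complex.I * x * ((t : ℂ) + ε * Complex.I)) *
      fF b α ((t : ℂ) + ε * Complex.I) =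
    (∫ t : ℝ, Complex.exp (-2 * Complex.I * x * ((t : ℂ) + (-ε : ℝ) * Complex.I)) *
      fF b α ((t : ℂ) + (-ε : ℝ) * Complex.I)) - 4 * Real.pi * x * α := by
  obtain ⟨h, hd, hh⟩ := aux_h b hb α x
  obtain ⟨C, hC, hbd⟩ := aux_bound b ε hb α hα
  have hεa : |ε| ≤ ε := (abs_of_pos hε0).le
  have hεa' : |-ε| ≤ ε := by rw [abs_neg]; exact hεa
  have hne : -ε ≠ 0 := by linarith
  have hE1 := aux_E_int b ε hb hε α hα (-ε) hne hεa' x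
  have hE2 := aux_E_int b ε hb hε α hα ε hε0.ne' hεa x
  obtain ⟨hq1, hq1'⟩ := aux_sq_int (-ε) hne
  obtain ⟨hq2, hq2'⟩ := aux_sq_int ε hε0.ne'
  obtain ⟨hr, hr'⟩ := aux_r ε hε0
  set k : ℝ → ℂ := fun t => h ((t : ℂ) + (-ε : ℝ) * Complex.I) - h ((t : ℂ) + ε * Complex.I) with hk
  have hkeq : k = fun t : ℝ =>
      ((Complex.exp (-2 * Complex.I * x * ((t : ℂ) + (-ε : ℝ) * Complex.I)) *
        fF b α ((t : ℂ) + (-ε : ℝ) * Complex.I)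
      - Complex.exp (-2 * Complex.I * x * ((t : ℂ) + ε * Complex.I)) *
        fF b α ((t : ℂ) + ε * Complex.I))
      - α * ((((t : ℂ) + (-ε : ℝ) * Complex.I) ^ 2)⁻¹ - (((t : ℂ) + ε * Complex.I) ^ 2)⁻¹))
      + 2 * Complex.I * x * α *
        (((t : ℂ) + (-ε : ℝ) * Complex.I)⁻¹ - ((t : ℂ) + ε * Complex.I)⁻¹) := by
    funext t
    rw [hk]
    simp only
    rw [hh _ (aux_line_ne (-ε) hne t), hh _ (aux_line_ne ε hε0.ne' t)]
    ring
  have hkint : Integrable k := by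
    rw [hkeq]
    exact ((hE1.sub hE2).sub ((hq1.sub hq2).const_mul α)).add (hr.const_mul _)
  have hkval : ∫ t, k t = ((∫ t : ℝ, Complex.exp (-2 * Complex.I * x * ((t : ℂ) + (-ε : ℝ) * Complex.I)) *
      fF b α ((t : ℂ) + (-ε : ℝ) * Complex.I)) - ∫ t : ℝ, Complex.exp (-2 * Complex.I * x * ((t : ℂ) + ε * Complex.I)) *
      fF b α ((t : ℂ) + ε * Complex.I)) + 2 * Complex.I * x * α * (2 * Real.pi * Complex.I) := by
    have hl := aux_lin hE1 hE2 hq1 hq2 hr α (2 * Complex.I * x * α)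
    rw [hr', hq1', hq2'] at hl
    rw [hkeq]
    refine hl.trans ?_
    ring
  -- the line is inside the strip
  have hcont : ∀ y : ℝ, |y| ≤ ε → Continuous (fun t : ℝ => h ((t : ℂ) + y * Complex.I)) := by
    intro y hy
    refine hd.continuousOn.comp_continuous (by fun_prop) ?_
    intro t
    have : |y| < Real.pi * min b b⁻¹ := hy.trans_lt hε
    simpa [stripS] using this
  set V : ℝ → ℂ := fun T => ∫ y : ℝ in (-ε)..ε, h ((T : ℂ) + y * Complex.I) with hV
  have hrect : ∀ T : ℝ, ∫ t in (-T)..T, k t = Complex.I * V (-T) - Complex.I * V T := by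
    intro T
    have hc := Complex.integral_boundary_rect_eq_zero_of_differentiableOn h
      (((-T : ℝ) : ℂ) + (-ε : ℝ) * Complex.I) ((T : ℂ) + ε * Complex.I) (hd.mono (by
        intro w hw
        have h2 := hw.2
        simp only [Set.mem_preimage] at h2
        have : w.im ∈ Set.uIcc (-ε) ε := by simpa using h2
        rw [Set.uIcc_of_le (by linarith)] at this
        have h3 : |w.im| ≤ ε := abs_le.2 this
        exact h3.trans_lt hε))
    have e1 : ((((-T : ℝ) : ℂ) + (-ε : ℝ) * Complex.I)).re = -T := by simp
    have e2 : ((((-T : ℝ) : ℂ) + (-ε : ℝ) * Complex.I)).im = -ε := by simp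
    have e3 : ((((T : ℝ) : ℂ) + (ε : ℝ) * Complex.I)).re = T := by simp
    have e4 : ((((T : ℝ) : ℂ) + (ε : ℝ) * Complex.I)).im = ε := by simp
    rw [e1, e2, e3, e4] at hc
    rw [hk, intervalIntegral.integral_sub ((hcont (-ε) hεa').intervalIntegrable _ _)
      ((hcont ε hεa).intervalIntegrable _ _)]
    simp only [smul_eq_mul] at hc
    simp only [hV]
    linear_combination hc
  -- vertical sides vanish
  have hVb : ∀ᶠ T : ℝ in cocompact ℝ, ‖V T‖ ≤
      (Real.exp (2 * |x| * ε) * C * ‖T‖⁻¹ + ‖α‖ * ‖T‖⁻¹ + 2 * |x| * ‖α‖ * ‖T‖⁻¹) * |ε - (-ε)| := by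
    have : ∀ᶠ t : ℝ in cocompact ℝ, 1 ≤ ‖t‖ :=
      (tendsto_norm_cocompact_atTop (E := ℝ)).eventually_ge_atTop 1
    filter_upwards [this] with T hT
    apply intervalIntegral.norm_integral_le_of_norm_le_const
    intro y hy
    rw [Set.uIoc_of_le (by linarith)] at hy
    have hya : |y| ≤ ε := abs_le.2 ⟨hy.1.le, hy.2⟩
    have hre : ((T : ℂ) + y * Complex.I).re = T := by simp
    have him : ((T : ℂ) + y * Complex.I).im = y := by simp
    have hb1 := hbd ((T : ℂ) + y * Complex.I) (by rw [hre]; exact hT) (by rw [him]; exact hya)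
    have hnorm := Complex.abs_re_le_norm ((T : ℂ) + y * Complex.I)
    have hE := aux_E_norm x ((T : ℂ) + y * Complex.I)
    rw [hre] at hb1 hnorm
    rw [him] at hE
    set w := (T : ℂ) + y * Complex.I with hw
    rw [← Real.norm_eq_abs] at hnorm
    have hw0 : w ≠ 0 := by
      rw [← norm_pos_iff]; linarith
    have hTp : 0 < ‖T‖ := by linarith
    have i1 : ‖w‖⁻¹ ≤ ‖T‖⁻¹ := inv_anti₀ hTp hnorm
    have i2 : (‖w‖ ^ 2)⁻¹ ≤ ‖T‖⁻¹ := inv_anti₀ hTp (by nlinarith)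
    have i3 : (1 + T ^ 2)⁻¹ ≤ ‖T‖⁻¹ := by
      apply inv_anti₀ hTp
      have : T ^ 2 = ‖T‖ ^ 2 := by rw [Real.norm_eq_abs, sq_abs]
      rw [this]; nlinarith
    have i4 : Real.exp (2 * x * y) ≤ Real.exp (2 * |x| * ε) := by
      apply Real.exp_le_exp.2
      have a1 : x * y ≤ |x| * |y| := by rw [← abs_mul]; exact le_abs_self _
      have a2 : |x| * |y| ≤ |x| * ε := mul_le_mul_of_nonneg_left hya (abs_nonneg x)
      linarith
    rw [hh w hw0]
    refine (norm_add_le _ _).trans ?_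
    refine add_le_add ((norm_sub_le _ _).trans (add_le_add ?_ ?_)) ?_
    · rw [norm_mul, hE, mul_assoc (Real.exp (2 * |x| * ε))]
      refine mul_le_mul i4 (hb1.trans ?_) (norm_nonneg _) (Real.exp_pos _).le
      gcongr
    · rw [norm_mul, norm_inv, norm_pow]
      gcongr
    · rw [norm_mul, norm_mul, norm_mul, norm_mul, norm_inv, Complex.norm_I, Complex.norm_ofNat,
        Complex.norm_real, Real.norm_eq_abs, mul_one]
      gcongr
  have hVt : Tendsto V (cocompact ℝ) (nhds 0) := by
    refine squeeze_zero_norm' hVb ?_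
    have h0 : Tendsto (fun T : ℝ => ‖T‖⁻¹) (cocompact ℝ) (nhds 0) :=
      tendsto_inv_atTop_zero.comp (tendsto_norm_cocompact_atTop (E := ℝ))
    have := (((h0.const_mul (Real.exp (2 * |x| * ε) * C)).add (h0.const_mul ‖α‖)).add
      (h0.const_mul (2 * |x| * ‖α‖))).mul_const |ε - (-ε)|
    simpa using this
  have hVtop : Tendsto V atTop (nhds 0) :=
    hVt.mono_left (by rw [cocompact_eq_atBot_atTop]; exact le_sup_right)
  have hVbot : Tendsto (fun T => V (-T)) atTop (nhds 0) :=
    (hVt.mono_left (by rw [cocompact_eq_atBot_atTop]; exact le_sup_left)).comp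
      tendsto_neg_atTop_atBot
  have hlim1 := intervalIntegral_tendsto_integral hkint tendsto_neg_atTop_atBot tendsto_id
  have hlim2 : Tendsto (fun T : ℝ => ∫ t in (-T)..T, k t) atTop (nhds 0) := by
    simp_rw [hrect]
    simpa using (hVbot.const_mul Complex.I).sub (hVtop.const_mul Complex.I)
  have hk0 : ∫ t, k t = 0 := tendsto_nhds_unique hlim1 hlim2
  rw [hkval] at hk0
  linear_combination -hk0 + (4 * x * α * Real.pi) * Complex.I_sq

lemma aux_Dfun (b ε : ℝ) (hb : 0 < b) (hε0 : 0 < ε)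
    (hε : ε < Real.pi * min b b⁻¹) (α : ℂ) (hα : |α.im| < (b + b⁻¹) / 2) (x : ℝ) :
    Dfun b ε α x * Complex.exp (2 * ((Real.pi : ℝ) : ℂ) * Complex.I * α * (x : ℂ)) =
    Complex.exp (Complex.I * (1 / 2 *
      ((∫ t : ℝ, Complex.exp (-2 * Complex.I * (-x : ℝ) * ((t : ℂ) + ε * Complex.I)) *
      fF b α ((t : ℂ) + ε * Complex.I)) +
      ∫ t : ℝ, Complex.exp (-2 * Complex.I * x * ((t : ℂ) + (-ε : ℝ) * Complex.I)) *
      fF b α ((t : ℂ) + (-ε : ℝ) * Complex.I)))) := by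
  have hεa : |ε| ≤ ε := (abs_of_pos hε0).le
  have hE2 := aux_E_int b ε hb hε α hα ε hε0.ne' hεa x
  have hE3 := aux_E_int b ε hb hε α hα ε hε0.ne' hεa (-x)
  have hs := aux_shift b ε hb hε0 hε α hα x
  have hI : (∫ t : ℝ,
      Complex.cos (2 * ((t : ℂ) + Complex.I * (ε : ℂ)) * x) *
          Complex.sin (2 * α * ((t : ℂ) + Complex.I * (ε : ℂ))) /
        (2 * ((t : ℂ) + Complex.I * (ε : ℂ)) *
          Complex.sinh ((b : ℂ) * ((t : ℂ) + Complex.I * (ε : ℂ))) *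
          Complex.sinh (((t : ℂ) + Complex.I * (ε : ℂ)) / (b : ℂ)))) =
      1 / 2 * ((∫ t : ℝ, Complex.exp (-2 * Complex.I * (-x : ℝ) * ((t : ℂ) + ε * Complex.I)) *
      fF b α ((t : ℂ) + ε * Complex.I)) +
      ∫ t : ℝ, Complex.exp (-2 * Complex.I * x * ((t : ℂ) + ε * Complex.I)) *
      fF b α ((t : ℂ) + ε * Complex.I)) := by
    rw [← integral_add hE3 hE2, ← integral_const_mul]
    congr 1
    funext t
    rw [mul_comm Complex.I (ε : ℂ), mul_div_assoc]
    simp only [fF]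
    rw [← add_mul, ← mul_assoc]
    congr 1
    rw [Complex.cos]
    have e1 : 2 * ((t : ℂ) + ε * Complex.I) * x * Complex.I =
      -2 * Complex.I * (-x : ℝ) * ((t : ℂ) + ε * Complex.I) := by push_cast; ring
    have e2 : -(2 * ((t : ℂ) + ε * Complex.I) * x) * Complex.I =
      -2 * Complex.I * x * ((t : ℂ) + ε * Complex.I) := by ring
    rw [e1, e2]
    ring
  rw [Dfun, hI, hs, ← Complex.exp_add]
  congr 1
  ring

lemma aux_top (b ε : ℝ) (hb : 0 < b) (hε0 : 0 < ε)
    (hε : ε < Real.pi * min b b⁻¹) (α : ℂ) (hα : |α.im| < (b + b⁻¹) / 2) :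
    Tendsto (fun x : ℝ => Dfun b ε α (x : ℂ) *
        Complex.exp (2 * ((Real.pi : ℝ) : ℂ) * Complex.I * α * (x : ℂ)))
      atTop (nhds 1) := by
  simp_rw [aux_Dfun b ε hb hε0 hε α hα]
  have hεa : |ε| ≤ ε := (abs_of_pos hε0).le
  have hεa' : |-ε| ≤ ε := by rw [abs_neg]; exact hεa
  have hne : -ε ≠ 0 := by linarith
  have hexp : Tendsto (fun x : ℝ => Real.exp (-(2 * ε * x))) atTop (nhds 0) :=
    Real.tendsto_exp_neg_atTop_nhds_zero.comp (tendsto_id.const_mul_atTop (by positivity))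
  have t1 : Tendsto (fun x : ℝ => ∫ t : ℝ, Complex.exp (-2 * Complex.I * (-x : ℝ) *
      ((t : ℂ) + ε * Complex.I)) * fF b α ((t : ℂ) + ε * Complex.I)) atTop (nhds 0) := by
    refine squeeze_zero_norm (fun x => aux_E_bound b α ε (-x)) ?_
    have := hexp.mul_const (∫ t : ℝ, ‖fF b α ((t : ℂ) + ε * Complex.I)‖)
    rw [zero_mul] at this
    refine this.congr fun x => ?_
    congr 2; ring
  have t2 : Tendsto (fun x : ℝ => ∫ t : ℝ, Complex.exp (-2 * Complex.I * x *
      ((t : ℂ) + (-ε : ℝ) * Complex.I)) * fF b α ((t : ℂ) + (-ε : ℝ) * Complex.I)) atTop (nhds 0) := by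
    refine squeeze_zero_norm (fun x => aux_E_bound b α (-ε) x) ?_
    have := hexp.mul_const (∫ t : ℝ, ‖fF b α ((t : ℂ) + (-ε : ℝ) * Complex.I)‖)
    rw [zero_mul] at this
    refine this.congr fun x => ?_
    congr 2; ring
  have t3 := (Complex.continuous_exp.tendsto _).comp
    (((t1.add t2).const_mul (1 / 2 : ℂ)).const_mul Complex.I)
  simpa [Function.comp_def] using t3

/-- The asymptotics of `D_α` along the real axis:
`D_α(x)·exp(2πiαx) → 1` as `x → +∞` and `D_α(x)·exp(−2πiαx) → 1` as `x → −∞`. -/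
theorem Dfun_asymptotics (b ε : ℝ) (hb : 0 < b) (hε0 : 0 < ε)
    (hε : ε < Real.pi * min b b⁻¹) (α : ℂ) (hα : |α.im| < (b + b⁻¹) / 2) :
    Tendsto (fun x : ℝ => Dfun b ε α (x : ℂ) *
        Complex.exp (2 * ((Real.pi : ℝ) : ℂ) * Complex.I * α * (x : ℂ)))
      atTop (nhds 1) ∧
    Tendsto (fun x : ℝ => Dfun b ε α (x : ℂ) *
        Complex.exp (-(2 * ((Real.pi : ℝ) : ℂ) * Complex.I * α * (x : ℂ))))
      atBot (nhds 1) := by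
  refine ⟨aux_top b ε hb hε0 hε α hα, ?_⟩
  refine ((aux_top b ε hb hε0 hε α hα).comp tendsto_neg_atBot_atTop).congr fun x => ?_
  simp only [Function.comp, Dfun, Complex.ofReal_neg, mul_neg, Complex.cos_neg]
end
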